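/- Let F be an algebraically closed field of characteristic zero. Then the Kaplansky superalgebra K₃ cannot be written as A + B for two proper nontrivial simple subsuperalgebras A and B. -/

import Mathlib

open Matrix

namespace SJ

section SuperDefs

variable {F : Type*} [Field F] {J : Type*} [AddCommGroup J] [Module F J]

/-- A graded subspace: `A = (A ∩ J₀) ⊕ (A ∩ J₁)`. -/
def IsGradedG (ev od : Submodule F J) (A : Submodule F J) : Prop :=
  A = (A ⊓ ev) ⊔ (A ⊓ od)

/-- A subsuperalgebra: a graded subspace closed under the product. -/
def IsSubalgG (mul : J → J → J) (ev od : Submodule F J) (A : Submodule F J) : Prop :=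
  IsGradedG ev od A ∧ ∀ x ∈ A, ∀ y ∈ A, mul x y ∈ A

/-- Nontrivial: `A ∩ J₁ ≠ {0}`. -/
def NontrivG (od : Submodule F J) (A : Submodule F J) : Prop := A ⊓ od ≠ ⊥

/-- Simple: `A∘A ≠ 0` and the only graded subspaces `I ⊆ A` with `A∘I ⊆ I` are `0` and `A`. -/
def IsSimpleG (mul : J → J → J) (ev od : Submodule F J) (A : Submodule F J) : Prop :=
  (∃ x ∈ A, ∃ y ∈ A, mul x y ≠ 0) ∧
  ∀ I : Submodule F J, I ≤ A → IsGradedG ev od I →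
    (∀ x ∈ A, ∀ y ∈ I, mul x y ∈ I) → I = ⊥ ∨ I = A

/-- An isomorphism of superalgebras: an F-linear bijection mapping even part onto even
part, odd part onto odd part, and preserving the product. -/
def SuperIsoG {J₂ : Type*} [AddCommGroup J₂] [Module F J₂]
    (mul₁ : J → J → J) (ev₁ od₁ : Submodule F J)
    (mul₂ : J₂ → J₂ → J₂) (ev₂ od₂ : Submodule F J₂)
    (A : Submodule F J) (B : Submodule F J₂) : Prop :=
  ∃ e : A ≃ₗ[F] B,
    (∀ x : A, (x : J) ∈ ev₁ ↔ (e x : J₂) ∈ ev₂) ∧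
    (∀ x : A, (x : J) ∈ od₁ ↔ (e x : J₂) ∈ od₂) ∧
    ∀ x y z : A, mul₁ x y = (z : J) → mul₂ (e x) (e y) = (e z : J₂)

end SuperDefs

section K3

variable (F : Type*) [Field F]

/-- The Kaplansky superalgebra `K₃ = Fe ⊕ (Fx ⊕ Fy)`, realized on `F × F × F` with
`e = (1,0,0)`, `x = (0,1,0)`, `y = (0,0,1)`.  The product is the bilinear extension of
`e∘e = e`, `e∘x = x∘e = x/2`, `e∘y = y∘e = y/2`, `x∘y = −(y∘x) = e`, `x∘x = y∘y = 0`. -/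
def k3mul (u v : F × F × F) : F × F × F :=
  (u.1 * v.1 + u.2.1 * v.2.2 - u.2.2 * v.2.1,
   (u.1 * v.2.1 + v.1 * u.2.1) / 2,
   (u.1 * v.2.2 + v.1 * u.2.2) / 2)

/-- The even part `Fe` of `K₃`. -/
def k3even : Submodule F (F × F × F) where
  carrier := {u | u.2.1 = 0 ∧ u.2.2 = 0}
  zero_mem' := ⟨rfl, rfl⟩
  add_mem' := by
    rintro ⟨a, b, c⟩ ⟨a', b', c'⟩ ⟨h1, h2⟩ ⟨g1, g2⟩
    constructor <;> simp_all
  smul_mem' := by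
    rintro t ⟨a, b, c⟩ ⟨h1, h2⟩
    constructor <;> simp_all

/-- The odd part `Fx ⊕ Fy` of `K₃`. -/
def k3odd : Submodule F (F × F × F) where
  carrier := {u | u.1 = 0}
  zero_mem' := rfl
  add_mem' := by
    rintro ⟨a, b, c⟩ ⟨a', b', c'⟩ h1 g1
    simp_all
  smul_mem' := by
    rintro t ⟨a, b, c⟩ h1
    simp_all

theorem k3_aux (F : Type*) [Field F] (A : Submodule F (F × F × F))
    (hA : IsSubalgG (k3mul F) (k3even F) (k3odd F) A) (hT : A ≠ ⊤)
    (hN : NontrivG (k3odd F) A) (hS : IsSimpleG (k3mul F) (k3even F) (k3odd F) A) : False := by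
  obtain ⟨hg, hm⟩ := hA
  obtain ⟨⟨x, hx, y, hy, hxy⟩, hI⟩ := hS
  have key : ∀ b c p q : F, ((0, b, c) : F × F × F) ∈ A → ((0, p, q) : F × F × F) ∈ A →
      b * q - c * p = 0 := by
    intro b c p q h1 h2
    by_contra hd
    apply hT
    rw [eq_top_iff]
    rintro ⟨r, s, t⟩ -
    have h3 := hm _ h1 _ h2
    have h4 := A.add_mem (A.add_mem (A.smul_mem (r / (b * q - c * p)) h3)
      (A.smul_mem ((s * q - t * p) / (b * q - c * p)) h1))
      (A.smul_mem ((b * t - c * s) / (b * q - c * p)) h2)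
    convert h4 using 1
    simp only [k3mul, Prod.smul_mk, Prod.mk_add_mk, smul_eq_mul, Prod.mk.injEq]
    refine ⟨?_, ?_, ?_⟩ <;> field_simp <;> ring
  have hideal : ∀ x ∈ A, ∀ y ∈ A ⊓ k3odd F, k3mul F x y ∈ A ⊓ k3odd F := by
    rintro x hx ⟨y0, p, q⟩ ⟨hy, hy0⟩
    refine ⟨hm _ hx _ hy, ?_⟩
    have hy0 : y0 = 0 := hy0
    subst hy0
    rw [hg] at hx
    obtain ⟨⟨a, b', c'⟩, ⟨_, h1, h2⟩, ⟨a', b, c⟩, ⟨hz, h3⟩, rfl⟩ := Submodule.mem_sup.1 hx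
    have h1 : b' = 0 := h1
    have h2 : c' = 0 := h2
    have h3 : a' = 0 := h3
    subst h1 h2 h3
    have := key _ _ _ _ hz hy
    change _ = _
    simp [k3mul, this]
  rcases hI (A ⊓ k3odd F) inf_le_left
    (le_antisymm (le_sup_of_le_right (le_inf le_rfl inf_le_right))
      (sup_le inf_le_left inf_le_left)) hideal with h | h
  · exact hN h
  · have hx' := hx
    have hy' := hy
    rw [← h] at hx' hy'
    obtain ⟨x0, b, c⟩ := x
    obtain ⟨y0, p, q⟩ := y
    have h1 : x0 = 0 := hx'.2
    have h2 : y0 = 0 := hy'.2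
    subst h1 h2
    apply hxy
    have := key _ _ _ _ hx hy
    simp [k3mul, this]

/-- over an algebraically closed field of characteristic zero, the
Kaplansky superalgebra `K₃` cannot be written as `A + B` for two proper nontrivial
simple subsuperalgebras `A` and `B`. -/
theorem no_simple_decomposition_K3
    (F : Type*) [Field F] [IsAlgClosed F] [CharZero F] :
    ¬ ∃ A B : Submodule F (F × F × F),
        IsSubalgG (k3mul F) (k3even F) (k3odd F) A ∧
        IsSubalgG (k3mul F) (k3even F) (k3odd F) B ∧
        A ≠ ⊤ ∧ B ≠ ⊤ ∧
        NontrivG (k3odd F) A ∧ NontrivG (k3odd F) B ∧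
        IsSimpleG (k3mul F) (k3even F) (k3odd F) A ∧
        IsSimpleG (k3mul F) (k3even F) (k3odd F) B ∧
        A ⊔ B = ⊤ := by
  rintro ⟨A, B, hA, _, hT, _, hN, _, hS, _, _⟩
  exact k3_aux F A hA hT hN hS

end K3

end SJ
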